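/- Let M be a real m×n matrix and let P be a real m×m orthogonal projection matrix of rank r (r ≤ m). Then ‖M − P·M‖₂² ≥ λ_r↓ + λ_{r+1}↓ + … + λ_{m−1}↓, where λ₀↓ ≥ λ₁↓ ≥ … ≥ λ_{m−1}↓ are the eigenvalues of M·Mᵀ in non-increasing order; that is, the distance from M to its image under any rank-r orthogonal projection is at least the sum of the m − r smallest eigenvalues of M·Mᵀ. -/

import Mathlib

open Matrix

namespace Matrix

/-- The trace of an idempotent matrix is its rank. -/
theorem trace_eq_rank_of_isIdempotentElem {K ι : Type*} [Field K] [Fintype ι] [DecidableEq ι]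
    {P : Matrix ι ι K} (hP : IsIdempotentElem P) : P.trace = (P.rank : K) := by
  have h : IsIdempotentElem (Matrix.toLin' P) := by
    rw [IsIdempotentElem, Module.End.mul_eq_comp, ← Matrix.toLin'_mul, hP.eq]
  rw [← Matrix.trace_toLin'_eq, (LinearMap.IsIdempotentElem.isProj_range _ h).trace]
  rfl

/-- The diagonal entries of a real orthogonal projection lie in `[0, 1]`. -/
theorem diag_mem_Icc_of_transpose_eq_of_isIdempotentElem {ι : Type*} [Fintype ι]
    {R : Matrix ι ι ℝ} (hT : Rᵀ = R) (hR : IsIdempotentElem R) (i : ι) :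
    R i i ∈ Set.Icc 0 1 := by
  have hsum : R i i = ∑ j, R i j ^ 2 := by
    conv_lhs => rw [← hR.eq, mul_apply]
    refine Finset.sum_congr rfl fun j _ => ?_
    rw [sq, ← transpose_apply R i j, hT]
  have hsq : R i i ^ 2 ≤ R i i := by
    conv_rhs => rw [hsum]
    exact Finset.single_le_sum (f := fun j => R i j ^ 2) (fun j _ => sq_nonneg _)
      (Finset.mem_univ i)
  constructor <;> nlinarith

end Matrix

/-- Among weights in `[0, 1]` of total mass `m - r`, the weighted sum of a nonincreasing sequence
of length `m` is minimized by the indicator of the last `m - r` indices. -/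
theorem Antitone.sum_filter_le_sum_mul {m : ℕ} {μ : Fin m → ℝ} (hμ : Antitone μ)
    {w : Fin m → ℝ} (hw : ∀ k, w k ∈ Set.Icc 0 1) {r : ℕ} (hr : r ≤ m)
    (hsum : ∑ k, w k = (m : ℝ) - r) :
    ∑ k ∈ Finset.univ.filter (fun k : Fin m => r ≤ (k : ℕ)), μ k ≤ ∑ k, w k * μ k := by
  obtain ⟨c, hlo, hhi⟩ : ∃ c, (∀ k : Fin m, (k : ℕ) < r → c ≤ μ k) ∧
      ∀ k : Fin m, r ≤ (k : ℕ) → μ k ≤ c := by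
    rcases hr.lt_or_eq with h | rfl
    · exact ⟨μ ⟨r, h⟩, fun k hk => hμ (Fin.le_def.2 hk.le), fun k hk => hμ (Fin.le_def.2 hk)⟩
    · obtain ⟨c, hc⟩ := (Set.finite_range μ).bddBelow
      exact ⟨c, fun k _ => hc ⟨k, rfl⟩, fun k hk => absurd k.isLt (not_lt.2 hk)⟩
  have hcard : ∑ k : Fin m, (if r ≤ (k : ℕ) then (1 : ℝ) else 0) = (m : ℝ) - r := by
    rw [Fin.sum_univ_eq_sum_range (fun k => if r ≤ k then (1 : ℝ) else 0), Finset.sum_boole]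
    have : (Finset.range m).filter (fun k => r ≤ k) = Finset.Ico r m := by
      ext k
      simp [and_comm]
    rw [this, Nat.card_Ico, Nat.cast_sub hr]
  have hnonneg : 0 ≤ ∑ k, (w k - if r ≤ (k : ℕ) then 1 else 0) * (μ k - c) := by
    refine Finset.sum_nonneg fun k _ => ?_
    split_ifs with h
    · exact mul_nonneg_of_nonpos_of_nonpos (sub_nonpos.2 (hw k).2) (sub_nonpos.2 (hhi k h))
    · rw [sub_zero]
      exact mul_nonneg (hw k).1 (sub_nonneg.2 (hlo k (not_le.1 h)))
  have hexpand : ∑ k, (w k - if r ≤ (k : ℕ) then 1 else 0) * (μ k - c) =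
      ∑ k, w k * μ k - (∑ k : Fin m, if r ≤ (k : ℕ) then μ k else 0) -
        (∑ k, w k - ∑ k : Fin m, if r ≤ (k : ℕ) then 1 else 0) * c := by
    rw [← Finset.sum_sub_distrib, ← Finset.sum_sub_distrib, Finset.sum_mul,
      ← Finset.sum_sub_distrib]
    refine Finset.sum_congr rfl fun k _ => ?_
    split_ifs <;> ring
  rw [hexpand, hsum, hcard, sub_self, zero_mul, sub_zero] at hnonneg
  rw [Finset.sum_filter]
  exact sub_nonneg.1 hnonneg

/-- The squared Frobenius distance from a real `m × n` matrix `M` to its image under a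
rank-`r` orthogonal projection `P` is at least the sum of the `m - r` smallest
eigenvalues of `M * Mᵀ`. -/
theorem sum_smallest_eigenvalues_le_frobenius_sq_sub_proj {m n : ℕ}
    (M : Matrix (Fin m) (Fin n) ℝ) (hH : (M * Mᵀ).IsHermitian)
    (P : Matrix (Fin m) (Fin m) ℝ) (hsymm : Pᵀ = P) (hidem : P * P = P)
    (r : ℕ) (hr : r ≤ m) (hrank : P.rank = r)
    (μ : Fin m → ℝ) (hanti : Antitone μ)
    (hperm : ∃ σ : Equiv.Perm (Fin m), μ = hH.eigenvalues ∘ σ) :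
    ∑ k ∈ Finset.univ.filter (fun k : Fin m => r ≤ (k : ℕ)), μ k ≤
      ((M - P * M) * (M - P * M)ᵀ).trace := by
  obtain ⟨σ, rfl⟩ := hperm
  obtain ⟨U, hU, hspec⟩ : ∃ U : Matrix (Fin m) (Fin m) ℝ, U * Uᵀ = 1 ∧
      M * Mᵀ = U * diagonal hH.eigenvalues * Uᵀ :=
    ⟨hH.eigenvectorUnitary, Unitary.mul_star_self_of_mem hH.eigenvectorUnitary.2,
      hH.spectral_theorem⟩
  generalize hH.eigenvalues = l at hanti hspec ⊢
  have hQT : (1 - P)ᵀ = 1 - P := by rw [transpose_sub, transpose_one, hsymm]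
  have hQ : IsIdempotentElem (1 - P) := IsIdempotentElem.one_sub hidem
  set R := Uᵀ * (1 - P) * U with hRdef
  have hRT : Rᵀ = R := by
    rw [hRdef, transpose_mul, transpose_mul, transpose_transpose, hQT, Matrix.mul_assoc]
  have hR : IsIdempotentElem R := by
    calc R * R = Uᵀ * (1 - P) * (U * Uᵀ) * (1 - P) * U := by simp only [hRdef, Matrix.mul_assoc]
      _ = Uᵀ * ((1 - P) * (1 - P)) * U := by rw [hU, Matrix.mul_one, Matrix.mul_assoc Uᵀ]
      _ = R := by rw [hQ.eq]
  have hRtrace : ∑ k, R k k = (m : ℝ) - r := by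
    change R.trace = _
    rw [hRdef, Matrix.mul_assoc, trace_mul_comm, Matrix.mul_assoc, hU, Matrix.mul_one, trace_sub,
      trace_one, trace_eq_rank_of_isIdempotentElem hidem, hrank, Fintype.card_fin]
  have htrace : ((M - P * M) * (M - P * M)ᵀ).trace = ∑ k, R k k * l k := by
    have hM : M - P * M = (1 - P) * M := by rw [Matrix.sub_mul, Matrix.one_mul]
    calc ((M - P * M) * (M - P * M)ᵀ).trace
        = ((1 - P) * (M * Mᵀ) * (1 - P)).trace := by
          rw [hM, transpose_mul, hQT]
          simp only [Matrix.mul_assoc]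
      _ = ((1 - P) * (M * Mᵀ)).trace := by
          rw [trace_mul_comm, ← Matrix.mul_assoc, hQ.eq]
      _ = (R * diagonal l).trace := by
          rw [hspec, ← Matrix.mul_assoc, trace_mul_comm]
          simp only [hRdef, Matrix.mul_assoc]
      _ = ∑ k, R k k * l k := by simp [trace, mul_diagonal]
  rw [htrace, ← Equiv.sum_comp σ]
  exact hanti.sum_filter_le_sum_mul
    (fun k => diag_mem_Icc_of_transpose_eq_of_isIdempotentElem hRT hR (σ k)) hr
    ((Equiv.sum_comp σ fun k => R k k).trans hRtrace)
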